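/- Let k ≥ 0 be an integer and set Φ(w) = ln^{[k+1]}(w) (the (k+1)-fold iterated logarithm). Then for every real w ≥ √(exp^{[k+1]}(1)) one has 0 ≤ 2w·Φ′(w) + w²·Φ″(w) ≤ 1; equivalently, with f(w) = Φ(w) + w·Φ′(w), one has 0 ≤ w·f′(w) ≤ 1 on this range. -/

import Mathlib

open Filter Topology

theorem HasDerivAt.eventually_comp_log {g p : ℝ → ℝ} {s : ℝ} (hs : s ≠ 0)
    (hg : ∀ᶠ t in 𝓝 (Real.log s), HasDerivAt g (p t) t) :
    ∀ᶠ t in 𝓝 s, HasDerivAt (fun t => g (Real.log t)) (p (Real.log t) / t) t := by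
  filter_upwards [(Real.continuousAt_log hs).eventually hg, eventually_ne_nhds hs] with t ht ht0
  simpa [div_eq_mul_inv, Function.comp_def] using ht.comp t (Real.hasDerivAt_log ht0)

theorem HasDerivAt.comp_log_div {p : ℝ → ℝ} {q s : ℝ} (hs : s ≠ 0)
    (hp : HasDerivAt p q (Real.log s)) :
    HasDerivAt (fun t => p (Real.log t) / t) ((q - p (Real.log s)) / s ^ 2) s := by
  refine ((hp.comp s (Real.hasDerivAt_log hs)).div (hasDerivAt_id s) hs).congr_deriv ?_
  simp [hs]

theorem two_le_iterate_exp_succ (n : ℕ) : 2 ≤ Real.exp^[n + 1] 1 := by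
  induction n with
  | zero => simpa using (by linarith [Real.add_one_le_exp 1] : (2 : ℝ) ≤ Real.exp 1)
  | succ n ih =>
    rw [Function.iterate_succ_apply']
    linarith [Real.add_one_le_exp (Real.exp^[n + 1] 1)]

/-- The first and second derivatives `p s` and `q` of the `n`-fold logarithm, with their bounds. -/
theorem exists_hasDerivAt_iterate_log (n : ℕ) {s : ℝ} (hs : Real.exp^[n] 1 / 2 ≤ s) :
    ∃ (p : ℝ → ℝ) (q : ℝ), (∀ᶠ t in 𝓝 s, HasDerivAt (fun t => Real.log^[n] t) (p t) t) ∧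
      HasDerivAt p q s ∧ 0 ≤ p s ∧ p s ≤ 1 ∧ 0 ≤ p s + q ∧ q ≤ 0 := by
  induction n generalizing s with
  | zero =>
    exact ⟨fun _ => 1, 0, .of_forall fun t => hasDerivAt_id t, hasDerivAt_const _ _, by norm_num⟩
  | succ n ih =>
    have hs1 : 1 ≤ s := by linarith [two_le_iterate_exp_succ n]
    have hs0 : s ≠ 0 := by positivity
    obtain _ | n := n
    · refine ⟨fun t => 1 / t, (0 - 1) / s ^ 2,
        HasDerivAt.eventually_comp_log (g := id) (p := fun _ => 1) hs0
          (.of_forall fun t => hasDerivAt_id t),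
        HasDerivAt.comp_log_div (p := fun _ => 1) hs0 (hasDerivAt_const _ _), by positivity, ?_, ?_, ?_⟩
      · exact (div_le_one (by positivity)).2 hs1
      · have : 1 / s + (0 - 1) / s ^ 2 = (s - 1) / s ^ 2 := by field_simp; ring
        rw [this]
        exact div_nonneg (by linarith) (by positivity)
      · exact div_nonpos_of_nonpos_of_nonneg (by norm_num) (by positivity)
    · have hE := two_le_iterate_exp_succ n
      rw [Function.iterate_succ_apply'] at hs
      set E := Real.exp^[n + 1] 1
      have hs2 : 2 ≤ s := by
        nlinarith [Real.quadratic_le_exp_of_nonneg (by linarith : 0 ≤ E)]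
      have hlog : E / 2 ≤ Real.log s := by
        rw [Real.le_log_iff_exp_le (by positivity)]
        have hsq : Real.exp E = Real.exp (E / 2) * Real.exp (E / 2) := by
          rw [← Real.exp_add, add_halves]
        nlinarith [Real.add_one_le_exp (E / 2)]
      obtain ⟨p, q, hg, hp, hp0, hp1, hpq, hq⟩ := ih hlog
      refine ⟨fun t => p (Real.log t) / t, (q - p (Real.log s)) / s ^ 2,
        HasDerivAt.eventually_comp_log hs0 hg, hp.comp_log_div hs0, by positivity, ?_, ?_, ?_⟩
      · exact (div_le_one (by positivity)).2 (hp1.trans hs1)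
      · have : p (Real.log s) / s + (q - p (Real.log s)) / s ^ 2 =
            (p (Real.log s) * (s - 1) + q) / s ^ 2 := by field_simp; ring
        simp only [this]
        exact div_nonneg (by nlinarith) (by positivity)
      · exact div_nonpos_of_nonpos_of_nonneg (by linarith) (by positivity)


/-- calculus claim from the proof of Theorem 3.1: with
`Φ = ln^{[k+1]}`, one has `0 ≤ 2wΦ'(w) + w²Φ''(w) ≤ 1` for
`w ≥ √(exp^{[k+1]}(1))`. -/
theorem stmt_11 (k : ℕ) (w : ℝ) (hw : Real.sqrt (Real.exp^[k + 1] 1) ≤ w) :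
    0 ≤ 2 * w * deriv (fun t : ℝ => Real.log^[k + 1] t) w +
        w ^ 2 * deriv (deriv (fun t : ℝ => Real.log^[k + 1] t)) w ∧
    2 * w * deriv (fun t : ℝ => Real.log^[k + 1] t) w +
        w ^ 2 * deriv (deriv (fun t : ℝ => Real.log^[k + 1] t)) w ≤ 1 := by
  have hw0 : 0 < w := (Real.sqrt_pos.2 (by linarith [two_le_iterate_exp_succ k])).trans_le hw
  have hlog : Real.exp^[k] 1 / 2 ≤ Real.log w := by
    rw [Function.iterate_succ_apply', ← Real.exp_half] at hw
    exact (Real.le_log_iff_exp_le hw0).2 hw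
  obtain ⟨p, q, hg, hp, -, hp1, hpq, hq⟩ := exists_hasDerivAt_iterate_log k hlog
  have hd : ∀ᶠ t in 𝓝 w,
      HasDerivAt (fun t => Real.log^[k + 1] t) (p (Real.log t) / t) t :=
    HasDerivAt.eventually_comp_log hw0.ne' hg
  have hd' : deriv (fun t => Real.log^[k + 1] t) =ᶠ[𝓝 w] fun t => p (Real.log t) / t :=
    hd.mono fun _ ht => ht.deriv
  rw [hd'.deriv_eq, hd'.eq_of_nhds, (hp.comp_log_div hw0.ne').deriv]
  have : 2 * w * (p (Real.log w) / w) + w ^ 2 * ((q - p (Real.log w)) / w ^ 2) =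
      p (Real.log w) + q := by field_simp; ring
  rw [this]
  exact ⟨hpq, by linarith⟩
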